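/- arXiv:1106.2058 — 2 statements merged into one kernel-verified Lean document; each statement's English description precedes it below -/
import Mathlib

section
/- The unique stationary distribution of the edge reconnecting Markov chain with parameter κ on A_n^m assigns to each B ∈ A_n^m the probability (∏_{i=1}^n ∏_{j=1}^{d(B,i)} (κ + j − 1)) / (∏_{j=1}^{2m} (κn + j − 1)) · m! · 2^{m'(B)} / ((∏_{i<j} B(i,j)!) · (∏_{i=1}^n (B(i,i)/2)!)), and this coincides with the distribution of the preferential attachment graph PAG_κ(n,m). -/
open Finset Nat

/-- The number of balls of color `i` in the urn configuration `ψ`. -/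
def colorCount {M n : ℕ} (ψ : Fin M → Fin n) (i : Fin n) : ℕ :=
  (Finset.univ.filter fun l => ψ l = i).card

/-- The closed-form Pólya urn probability. -/
noncomputable def polyaProb (κ : ℝ) {M n : ℕ} (ψ : Fin M → Fin n) : ℝ :=
  (∏ i : Fin n, ∏ j ∈ Finset.range (colorCount ψ i), (κ + j)) /
    ∏ j ∈ Finset.range M, (κ * n + j)

/-- The adjacency matrix obtained from `ψ : [2m] → [n]` by the stub-pairing map. -/
def stubAdj {m n : ℕ} (ψ : Fin (2 * m) → Fin n) (i j : Fin n) : ℕ :=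
  ∑ e : Fin m,
    ((if ψ ⟨2 * (e : ℕ), by have := e.isLt; omega⟩ = i ∧
         ψ ⟨2 * (e : ℕ) + 1, by have := e.isLt; omega⟩ = j then 1 else 0) +
     (if ψ ⟨2 * (e : ℕ), by have := e.isLt; omega⟩ = j ∧
         ψ ⟨2 * (e : ℕ) + 1, by have := e.isLt; omega⟩ = i then 1 else 0))

/-- The degree `d(B,i) = ∑_j B(i,j)`. -/
def degB {n : ℕ} (B : Fin n → Fin n → ℕ) (i : Fin n) : ℕ := ∑ j, B i j

/-- The number `m'(B) = ∑_{i<j} B(i,j)` of non-loop edges. -/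
def nonloop {n : ℕ} (B : Fin n → Fin n → ℕ) : ℕ :=
  ∑ i : Fin n, ∑ j : Fin n, if i < j then B i j else 0

/-- The adjacency matrix of a single edge `{i,j}` (so the diagonal gets `2` for a loop). -/
def edgeMat {n : ℕ} (i j x y : Fin n) : ℕ :=
  (if x = i ∧ y = j then 1 else 0) + (if x = j ∧ y = i then 1 else 0)

/-- The result of reconnecting an edge `{a,b}` of `B`: the endpoint `b` is detached and
reattached to the vertex `v`, giving the multigraph `B − e_{ab} + e_{av}`. -/
def reconnect {n : ℕ} (B : Fin n → Fin n → ℕ) (a b v : Fin n) (x y : Fin n) : ℕ :=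
  B x y - edgeMat a b x y + edgeMat a v x y

/-- The transition probability of the edge reconnecting Markov chain with parameter `κ`:
pick a uniform edge, pick one of its endpoints with a fair coin (so the ordered pair
`(a,b)` of kept/moved endpoints has probability `B(a,b)/(2m)`), and reconnect the moved
endpoint to `v` with probability `(d(v)+κ)/(2m+nκ)`. -/
noncomputable def reconnectKernel (κ : ℝ) (n m : ℕ)
    (B B' : Fin n → Fin n → ℕ) : ℝ :=
  ∑ a : Fin n, ∑ b : Fin n, ∑ v : Fin n,
    ((B a b : ℝ) / (2 * m)) * (((degB B v : ℝ) + κ) / (2 * m + n * κ)) *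
      (if B' = reconnect B a b v then 1 else 0)

/-- The state space `A_n^m`, realized as the image of the stub-pairing map. -/
def stateSpace (n m : ℕ) : Finset (Fin n → Fin n → ℕ) :=
  Finset.image (fun ψ : Fin (2 * m) → Fin n => fun i j => stubAdj ψ i j) Finset.univ

/-- The distribution of the preferential attachment graph `PAG_κ(n,m)`: the pushforward
of the Pólya urn distribution under the stub-pairing map. -/
noncomputable def pagDist (κ : ℝ) (n m : ℕ) (B : Fin n → Fin n → ℕ) : ℝ :=
  ∑ ψ ∈ Finset.univ.filter
      (fun ψ : Fin (2 * m) → Fin n => (fun i j => stubAdj ψ i j) = B),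
    polyaProb κ ψ

theorem colorCount_eq_sum {M n : ℕ} (ψ : Fin M → Fin n) (i : Fin n) :
    colorCount ψ i = ∑ l, if ψ l = i then 1 else 0 := by
  simp [colorCount]

theorem polyaProb_pos {κ : ℝ} (hκ : 0 < κ) {M n : ℕ} (hn : 0 < n) (ψ : Fin M → Fin n) :
    0 < polyaProb κ ψ := by
  have : (0 : ℝ) < n := by exact_mod_cast hn
  unfold polyaProb
  exact div_pos (prod_pos fun i _ => prod_pos fun j _ => by positivity)
    (prod_pos fun j _ => by positivity)

theorem polyaProb_congr (κ : ℝ) {M n : ℕ} {ψ ξ : Fin M → Fin n}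
    (h : ∀ i, colorCount ψ i = colorCount ξ i) : polyaProb κ ψ = polyaProb κ ξ := by
  simp only [polyaProb, h]

theorem sum_colorCount {M n : ℕ} (ψ : Fin M → Fin n) : ∑ i, colorCount ψ i = M := by
  simp only [colorCount_eq_sum]
  rw [sum_comm]
  simp

theorem colorCount_snoc {M n : ℕ} (ψ : Fin M → Fin n) (v i : Fin n) :
    colorCount (Fin.snoc ψ v : Fin (M + 1) → Fin n) i =
      colorCount ψ i + if v = i then 1 else 0 := by
  rw [colorCount_eq_sum, colorCount_eq_sum, Fin.sum_univ_castSucc]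
  simp only [Fin.snoc_castSucc, Fin.snoc_last]

theorem colorCount_update {M n : ℕ} (ψ : Fin M → Fin n) (l : Fin M) (v i : Fin n) :
    colorCount (Function.update ψ l v) i + (if ψ l = i then 1 else 0) =
      colorCount ψ i + if v = i then 1 else 0 := by
  simp only [colorCount_eq_sum]
  rw [← add_sum_erase _ _ (mem_univ l), ← add_sum_erase _ _ (mem_univ l),
    sum_congr rfl fun x hx => by rw [Function.update_of_ne (ne_of_mem_erase hx)],
    Function.update_self]
  omega

/-- A product changes by the factor `c` when a single factor does. -/
theorem prod_eq_prod_mul_of_single {ι : Type*} [Fintype ι] [DecidableEq ι] {f g : ι → ℝ} (a : ι)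
    {c : ℝ} (h : ∀ i, i ≠ a → f i = g i) (ha : f a = g a * c) : ∏ i, f i = (∏ i, g i) * c := by
  rw [← mul_prod_erase _ _ (mem_univ a), ← mul_prod_erase _ g (mem_univ a), ha,
    prod_congr rfl fun i hi => h i (ne_of_mem_erase hi)]
  ring

theorem polyaProb_snoc (κ : ℝ) {M n : ℕ} (ψ : Fin M → Fin n) (v : Fin n) :
    polyaProb κ (Fin.snoc ψ v : Fin (M + 1) → Fin n) =
      polyaProb κ ψ * ((colorCount ψ v + κ) / (M + n * κ)) := by
  unfold polyaProb
  rw [prod_eq_prod_mul_of_single (g := fun i => ∏ j ∈ range (colorCount ψ i), (κ + j)) v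
    (c := κ + colorCount ψ v), prod_range_succ, _root_.div_mul_div_comm, add_comm κ,
    mul_comm (n : ℝ) κ, add_comm (M : ℝ)]
  · intro i hi
    simp [colorCount_snoc, hi.symm]
  · simp [colorCount_snoc, prod_range_succ]

theorem polyaProb_snoc_update (κ : ℝ) {M n : ℕ} (ψ : Fin M → Fin n) (l : Fin M) (v : Fin n) :
    polyaProb κ (Fin.snoc (Function.update ψ l v) (ψ l) : Fin (M + 1) → Fin n) =
      polyaProb κ (Fin.snoc ψ v : Fin (M + 1) → Fin n) :=
  polyaProb_congr κ fun i => by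
    rw [colorCount_snoc, colorCount_snoc, colorCount_update]

theorem sum_colorCount_add_div {κ : ℝ} (hκ : 0 < κ) {M n : ℕ} (hn : 0 < n) (ψ : Fin M → Fin n) :
    ∑ v, ((colorCount ψ v : ℝ) + κ) / (M + n * κ) = 1 := by
  have : (0 : ℝ) < n := by exact_mod_cast hn
  rw [← sum_div, sum_add_distrib, ← Nat.cast_sum, sum_colorCount]
  simp only [sum_const, Finset.card_univ, Fintype.card_fin, nsmul_eq_mul]
  exact div_self (by positivity)

theorem sum_polyaProb {κ : ℝ} (hκ : 0 < κ) {n : ℕ} (hn : 0 < n) (M : ℕ) :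
    ∑ ψ : Fin M → Fin n, polyaProb κ ψ = 1 := by
  induction M with
  | zero => simp [polyaProb, colorCount]
  | succ M ih =>
    rw [← (Fin.snocEquiv fun _ => Fin n).sum_comp, Fintype.sum_prod_type_right, ← ih]
    refine sum_congr rfl fun ψ _ => ?_
    simp only [Fin.snocEquiv, Equiv.coe_fn_mk]
    simp only [polyaProb_snoc, ← mul_sum, sum_colorCount_add_div hκ hn, mul_one]

theorem sum_update_comm {M n : ℕ} (l : Fin M) (F : (Fin M → Fin n) → Fin n → ℝ) :
    ∑ ψ, ∑ v, F (Function.update ψ l v) (ψ l) = ∑ ψ, ∑ v, F ψ v := by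
  have hinv : Function.Involutive
      fun p : (Fin M → Fin n) × Fin n => (Function.update p.1 l p.2, p.1 l) := by
    rintro ⟨ψ, v⟩
    simp
  rw [← Fintype.sum_prod_type' F,
    ← Fintype.sum_prod_type' fun ψ v => F (Function.update ψ l v) (ψ l)]
  exact Equiv.sum_comp hinv.toPerm fun p : (Fin M → Fin n) × Fin n => F p.1 p.2

theorem sum_fin_two_mul {α : Type*} [AddCommMonoid α] {m : ℕ} (F : Fin (2 * m) → α) :
    ∑ l, F l = ∑ e : Fin m, (F ⟨2 * (e : ℕ), by omega⟩ + F ⟨2 * (e : ℕ) + 1, by omega⟩) := by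
  induction m with
  | zero => simp
  | succ m ih =>
    rw [Fin.sum_univ_castSucc]
    change ∑ l : Fin (2 * m + 1 + 1), F l = _
    rw [Fin.sum_univ_castSucc, Fin.sum_univ_castSucc, ih, add_assoc]
    rfl

/-- The other end of the edge to which the stub `l` belongs. -/
def partner {m : ℕ} (l : Fin (2 * m)) : Fin (2 * m) :=
  ⟨if (l : ℕ) % 2 = 0 then l + 1 else l - 1, by split_ifs <;> omega⟩

theorem partner_even {m : ℕ} (e : Fin m) (h : 2 * (e : ℕ) < 2 * m) :
    partner ⟨2 * (e : ℕ), h⟩ = ⟨2 * (e : ℕ) + 1, by omega⟩ := by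
  simp [partner]

theorem partner_odd {m : ℕ} (e : Fin m) (h : 2 * (e : ℕ) + 1 < 2 * m) :
    partner ⟨2 * (e : ℕ) + 1, h⟩ = ⟨2 * (e : ℕ), by omega⟩ := by
  simp [partner]

theorem stubAdj_eq_sum_partner {m n : ℕ} (ψ : Fin (2 * m) → Fin n) (i j : Fin n) :
    stubAdj ψ i j = ∑ l, if ψ (partner l) = i ∧ ψ l = j then 1 else 0 := by
  rw [sum_fin_two_mul, stubAdj]
  refine sum_congr rfl fun e _ => ?_
  rw [partner_even, partner_odd, add_comm]
  congr 2
  exact propext and_comm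

theorem stubAdj_eq_sum_edgeMat {m n : ℕ} (ψ : Fin (2 * m) → Fin n) (i j : Fin n) :
    stubAdj ψ i j = ∑ e : Fin m,
      edgeMat (ψ ⟨2 * (e : ℕ), by omega⟩) (ψ ⟨2 * (e : ℕ) + 1, by omega⟩) i j := by
  simp only [stubAdj, edgeMat, eq_comm (a := i), eq_comm (a := j)]
  refine sum_congr rfl fun e _ => ?_
  congr 2
  exact propext and_comm

theorem degB_stubAdj {m n : ℕ} (ψ : Fin (2 * m) → Fin n) (i : Fin n) :
    degB (fun i j => stubAdj ψ i j) i = colorCount ψ i := by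
  simp only [degB, stubAdj, colorCount_eq_sum]
  rw [sum_comm, sum_fin_two_mul]
  refine sum_congr rfl fun e _ => ?_
  simp [sum_add_distrib, ite_and]

theorem edgeMat_comm {n : ℕ} (a b : Fin n) : edgeMat a b = edgeMat b a := by
  ext x y
  simp only [edgeMat, add_comm]

theorem exists_edge_eq {m : ℕ} (l : Fin (2 * m)) : ∃ e : Fin m,
    l = ⟨2 * (e : ℕ), by omega⟩ ∨ l = ⟨2 * (e : ℕ) + 1, by omega⟩ := by
  refine ⟨⟨l / 2, by omega⟩, ?_⟩
  simp only [Fin.ext_iff]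
  omega

theorem stubAdj_add_edgeMat {m n : ℕ} (ψ : Fin (2 * m) → Fin n) (l : Fin (2 * m))
    (v x y : Fin n) :
    stubAdj ψ x y + edgeMat (ψ (partner l)) v x y =
      stubAdj (Function.update ψ l v) x y + edgeMat (ψ (partner l)) (ψ l) x y := by
  obtain ⟨e, he⟩ := exists_edge_eq l
  simp only [stubAdj_eq_sum_edgeMat]
  rw [← add_sum_erase _ _ (mem_univ e), ← add_sum_erase _ _ (mem_univ e)]
  have hrest : ∀ e' ∈ univ.erase e,
      edgeMat (Function.update ψ l v ⟨2 * (e' : ℕ), by omega⟩)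
        (Function.update ψ l v ⟨2 * (e' : ℕ) + 1, by omega⟩) x y =
      edgeMat (ψ ⟨2 * (e' : ℕ), by omega⟩) (ψ ⟨2 * (e' : ℕ) + 1, by omega⟩) x y := by
    intro e' he'
    have hne : (e' : ℕ) ≠ e := fun h => ne_of_mem_erase he' (Fin.ext h)
    rw [Function.update_of_ne, Function.update_of_ne] <;>
    · rcases he with rfl | rfl <;> simp only [ne_eq, Fin.ext_iff] <;> omega
  rw [sum_congr rfl hrest]
  rcases he with rfl | rfl
  · rw [partner_even, Function.update_self, Function.update_of_ne (by simp),
      edgeMat_comm v, edgeMat_comm (ψ ⟨2 * (e : ℕ), _⟩)]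
    omega
  · rw [partner_odd, Function.update_self, Function.update_of_ne (by simp)]
    omega

theorem edgeMat_le_stubAdj {m n : ℕ} (ψ : Fin (2 * m) → Fin n) (l : Fin (2 * m)) (x y : Fin n) :
    edgeMat (ψ (partner l)) (ψ l) x y ≤ stubAdj ψ x y := by
  obtain ⟨e, he⟩ := exists_edge_eq l
  rw [stubAdj_eq_sum_edgeMat, ← add_sum_erase _ _ (mem_univ e)]
  rcases he with rfl | rfl
  · rw [partner_even, edgeMat_comm]
    omega
  · rw [partner_odd]
    omega

theorem reconnect_stubAdj {m n : ℕ} (ψ : Fin (2 * m) → Fin n) (l : Fin (2 * m)) (v : Fin n) :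
    reconnect (fun i j => stubAdj ψ i j) (ψ (partner l)) (ψ l) v =
      fun i j => stubAdj (Function.update ψ l v) i j := by
  ext x y
  have h := stubAdj_add_edgeMat ψ l v x y
  have h' := edgeMat_le_stubAdj ψ l x y
  simp only [reconnect]
  omega

theorem sum_stubAdj_mul {m n : ℕ} (ψ : Fin (2 * m) → Fin n) (G : Fin n → Fin n → ℝ) :
    ∑ a, ∑ b, (stubAdj ψ a b : ℝ) * G a b = ∑ l, G (ψ (partner l)) (ψ l) := by
  simp only [stubAdj_eq_sum_partner, Nat.cast_sum, sum_mul, Nat.cast_ite, Nat.cast_one,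
    Nat.cast_zero, ite_mul, one_mul, zero_mul]
  rw [sum_congr rfl fun a _ => sum_comm, sum_comm]
  refine sum_congr rfl fun l _ => ?_
  simp [ite_and]

theorem reconnectKernel_stubAdj (κ : ℝ) {n m : ℕ} (ψ : Fin (2 * m) → Fin n)
    (B' : Fin n → Fin n → ℕ) :
    reconnectKernel κ n m (fun i j => stubAdj ψ i j) B' =
      ∑ l, ∑ v, ((2 * m : ℝ))⁻¹ * (((colorCount ψ v : ℝ) + κ) / (2 * m + n * κ)) *
        if (fun i j => stubAdj (Function.update ψ l v) i j) = B' then 1 else 0 := by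
  simp only [← reconnect_stubAdj, ← degB_stubAdj]
  rw [← sum_stubAdj_mul ψ fun a b => ∑ v, ((2 * m : ℝ))⁻¹ *
    (((degB (fun i j => stubAdj ψ i j) v : ℝ) + κ) / (2 * m + n * κ)) *
      if reconnect (fun i j => stubAdj ψ i j) a b v = B' then 1 else 0]
  simp only [reconnectKernel, mul_sum, div_eq_mul_inv, eq_comm (a := B'), mul_assoc]

theorem stubAdj_mem_stateSpace {m n : ℕ} (ψ : Fin (2 * m) → Fin n) :
    (fun i j => stubAdj ψ i j) ∈ stateSpace n m :=
  mem_image_of_mem _ (mem_univ ψ)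

theorem sum_reconnectKernel_mul (κ : ℝ) {n m : ℕ} (ψ : Fin (2 * m) → Fin n)
    (h : (Fin n → Fin n → ℕ) → ℝ) :
    ∑ B' ∈ stateSpace n m, reconnectKernel κ n m (fun i j => stubAdj ψ i j) B' * h B' =
      ∑ l, ∑ v, ((2 * m : ℝ))⁻¹ * (((colorCount ψ v : ℝ) + κ) / (2 * m + n * κ)) *
        h fun i j => stubAdj (Function.update ψ l v) i j := by
  simp only [reconnectKernel_stubAdj, sum_mul]
  rw [sum_comm]
  refine sum_congr rfl fun l _ => ?_
  rw [sum_comm]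
  refine sum_congr rfl fun v _ => ?_
  simp [mul_assoc, stubAdj_mem_stateSpace]

theorem sum_stub_weights {κ : ℝ} (hκ : 0 < κ) {n m : ℕ} (hn : 0 < n) (hm : 0 < m)
    (ψ : Fin (2 * m) → Fin n) :
    ∑ _l : Fin (2 * m), ∑ v,
      ((2 * m : ℝ))⁻¹ * (((colorCount ψ v : ℝ) + κ) / (2 * m + n * κ)) = 1 := by
  have h := sum_colorCount_add_div hκ hn ψ
  push_cast at h
  simp only [← mul_sum, h]
  have : (m : ℝ) ≠ 0 := by positivity
  simp only [sum_const, Finset.card_univ, Fintype.card_fin, nsmul_eq_mul, mul_one]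
  push_cast
  field_simp

theorem reconnectKernel_detailed_balance (κ : ℝ) (n m : ℕ) (B B' : Fin n → Fin n → ℕ) :
    pagDist κ n m B * reconnectKernel κ n m B B' =
      pagDist κ n m B' * reconnectKernel κ n m B' B := by
  have flow : ∀ B B' : Fin n → Fin n → ℕ, pagDist κ n m B * reconnectKernel κ n m B B' =
      ∑ l : Fin (2 * m), ∑ ψ : Fin (2 * m) → Fin n, ∑ v, ((2 * m : ℝ))⁻¹ *
        polyaProb κ (Fin.snoc ψ v : Fin (2 * m + 1) → Fin n) *
        ((if (fun i j => stubAdj ψ i j) = B then 1 else 0) *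
          if (fun i j => stubAdj (Function.update ψ l v) i j) = B' then 1 else 0) := by
    intro B B'
    rw [pagDist, sum_mul, sum_filter, sum_comm]
    refine sum_congr rfl fun ψ _ => ?_
    split_ifs with h
    · subst h
      simp only [reconnectKernel_stubAdj, mul_sum, polyaProb_snoc]
      push_cast
      refine sum_congr rfl fun l _ => sum_congr rfl fun v _ => ?_
      ring
    · simp
  rw [flow, flow]
  refine sum_congr rfl fun l _ => ?_
  rw [← sum_update_comm l]
  refine sum_congr rfl fun ψ _ => sum_congr rfl fun v _ => ?_
  rw [polyaProb_snoc_update, Function.update_idem, Function.update_eq_self,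
    mul_comm (ite _ (1 : ℝ) 0)]

theorem sum_reconnectKernel {κ : ℝ} (hκ : 0 < κ) {n m : ℕ} (hn : 0 < n) (hm : 0 < m)
    {B : Fin n → Fin n → ℕ} (hB : B ∈ stateSpace n m) :
    ∑ B' ∈ stateSpace n m, reconnectKernel κ n m B B' = 1 := by
  obtain ⟨ψ, -, rfl⟩ := mem_image.1 hB
  have h := sum_reconnectKernel_mul κ ψ fun _ => 1
  simp only [mul_one] at h
  exact h.trans (sum_stub_weights hκ hn hm ψ)

theorem pagDist_pos {κ : ℝ} (hκ : 0 < κ) {n m : ℕ} (hn : 0 < n)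
    {B : Fin n → Fin n → ℕ} (hB : B ∈ stateSpace n m) : 0 < pagDist κ n m B := by
  obtain ⟨ψ, -, rfl⟩ := mem_image.1 hB
  exact sum_pos (fun ξ _ => polyaProb_pos hκ hn ξ) ⟨ψ, by simp⟩

theorem sum_pagDist {κ : ℝ} (hκ : 0 < κ) {n : ℕ} (hn : 0 < n) (m : ℕ) :
    ∑ B ∈ stateSpace n m, pagDist κ n m B = 1 := by
  rw [← sum_polyaProb hκ hn (2 * m)]
  exact sum_fiberwise_of_maps_to (fun ψ _ => stubAdj_mem_stateSpace ψ) _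

/-- A function of urn configurations that is harmonic for single-stub resampling is constant. -/
theorem eq_of_harmonic {κ : ℝ} (hκ : 0 < κ) {n m : ℕ} (hn : 0 < n) (hm : 0 < m)
    {g : (Fin (2 * m) → Fin n) → ℝ}
    (hg : ∀ ψ, g ψ = ∑ l, ∑ v, ((2 * m : ℝ))⁻¹ *
      (((colorCount ψ v : ℝ) + κ) / (2 * m + n * κ)) * g (Function.update ψ l v))
    (ξ ξ' : Fin (2 * m) → Fin n) : g ξ = g ξ' := by
  have : Nonempty (Fin n) := ⟨⟨0, hn⟩⟩
  obtain ⟨ψ₀, hmax⟩ := Finite.exists_max g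
  have step : ∀ ψ, g ψ = g ψ₀ → ∀ l v, g (Function.update ψ l v) = g ψ₀ := by
    intro ψ hψ l v
    have hzero : ∑ l, ∑ v, ((2 * m : ℝ))⁻¹ *
        (((colorCount ψ v : ℝ) + κ) / (2 * m + n * κ)) *
          (g ψ₀ - g (Function.update ψ l v)) = 0 := by
      simp only [mul_sub, sum_sub_distrib, ← hg, ← sum_mul]
      rw [sum_stub_weights hκ hn hm, hψ]
      ring
    have hpos : ∀ v, 0 < ((2 * m : ℝ))⁻¹ * (((colorCount ψ v : ℝ) + κ) / (2 * m + n * κ)) :=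
      fun v => by positivity
    have hnonneg : ∀ l v, 0 ≤ ((2 * m : ℝ))⁻¹ *
        (((colorCount ψ v : ℝ) + κ) / (2 * m + n * κ)) *
          (g ψ₀ - g (Function.update ψ l v)) :=
      fun l v => mul_nonneg (hpos v).le (sub_nonneg.2 (hmax _))
    have hl := (sum_eq_zero_iff_of_nonneg fun l _ => sum_nonneg fun v _ => hnonneg l v).1
      hzero l (mem_univ l)
    have hv := (sum_eq_zero_iff_of_nonneg fun v _ => hnonneg l v).1 hl v (mem_univ v)
    rcases mul_eq_zero.1 hv with h | h
    · exact absurd h (hpos v).ne'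
    · linarith
  have reach : ∀ (ξ : Fin (2 * m) → Fin n) (s : Finset (Fin (2 * m))),
      g (s.piecewise ξ ψ₀) = g ψ₀ := by
    intro ξ s
    induction s using Finset.induction_on with
    | empty => simp
    | insert l s _ ih =>
      rw [piecewise_insert]
      exact step _ ih _ _
  have hξ := reach ξ univ
  have hξ' := reach ξ' univ
  rw [piecewise_univ] at hξ hξ'
  rw [hξ, hξ']

theorem pagDist_stationary {κ : ℝ} (hκ : 0 < κ) {n m : ℕ} (hn : 0 < n) (hm : 0 < m)
    {B' : Fin n → Fin n → ℕ} (hB' : B' ∈ stateSpace n m) :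
    ∑ B ∈ stateSpace n m, pagDist κ n m B * reconnectKernel κ n m B B' = pagDist κ n m B' := by
  simp only [reconnectKernel_detailed_balance κ n m _ B', ← mul_sum,
    sum_reconnectKernel hκ hn hm hB', mul_one]

theorem eq_pagDist_of_stationary {κ : ℝ} (hκ : 0 < κ) {n m : ℕ} (hn : 0 < n) (hm : 0 < m)
    {p : (Fin n → Fin n → ℕ) → ℝ} (hsum : ∑ B ∈ stateSpace n m, p B = 1)
    (hp : ∀ B' ∈ stateSpace n m,
      ∑ B ∈ stateSpace n m, p B * reconnectKernel κ n m B B' = p B')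
    {B : Fin n → Fin n → ℕ} (hB : B ∈ stateSpace n m) : p B = pagDist κ n m B := by
  have harm : ∀ B ∈ stateSpace n m, p B / pagDist κ n m B =
      ∑ B' ∈ stateSpace n m, reconnectKernel κ n m B B' * (p B' / pagDist κ n m B') := by
    intro B hB
    rw [div_eq_iff (pagDist_pos hκ hn hB).ne', ← hp B hB, sum_mul]
    refine sum_congr rfl fun B' hB' => ?_
    have hne := (pagDist_pos hκ hn hB').ne'
    have hbal := reconnectKernel_detailed_balance κ n m B B'
    field_simp
    linear_combination (-p B') * hbal
  have hconst := eq_of_harmonic hκ hn hm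
    (g := fun ψ => p (fun i j => stubAdj ψ i j) / pagDist κ n m fun i j => stubAdj ψ i j)
    fun ψ => by
      rw [harm _ (stubAdj_mem_stateSpace ψ)]
      exact sum_reconnectKernel_mul κ ψ fun B => p B / pagDist κ n m B
  obtain ⟨ξ, -, rfl⟩ := mem_image.1 hB
  set c := p (fun i j => stubAdj ξ i j) / pagDist κ n m fun i j => stubAdj ξ i j with hc
  have hprop : ∀ B ∈ stateSpace n m, p B = c * pagDist κ n m B := by
    intro B hB
    have hpos := pagDist_pos hκ hn hB
    obtain ⟨ψ, -, rfl⟩ := mem_image.1 hB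
    rw [hc, ← div_eq_iff hpos.ne']
    exact hconst ψ ξ
  have hc1 : c = 1 := by
    rw [sum_congr rfl hprop, ← mul_sum, sum_pagDist hκ hn, mul_one] at hsum
    exact hsum
  rw [hprop _ hB, hc1, one_mul]

/-- The contribution of the entry `(i, j)` with value `x` to the number of edge orderings and
orientations of a multigraph. -/
noncomputable def entryWeight {n : ℕ} (i j : Fin n) (x : ℕ) : ℝ :=
  if i < j then 2 ^ x / (x ! : ℝ) else if i = j then ((x / 2)! : ℝ)⁻¹ else 1

/-- The number of edge orderings and orientations of a multigraph with `m` edges, divided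
by `m !`. -/
noncomputable def multigraphWeight {n : ℕ} (B : Fin n → Fin n → ℕ) : ℝ :=
  ∏ p : Fin n × Fin n, entryWeight p.1 p.2 (B p.1 p.2)

theorem multigraphWeight_eq {n : ℕ} (B : Fin n → Fin n → ℕ) :
    multigraphWeight B = 2 ^ nonloop B /
      ((∏ i : Fin n, ∏ j : Fin n, if i < j then ((B i j)! : ℝ) else 1) *
        ∏ i : Fin n, ((B i i / 2)! : ℝ)) := by
  have hdiag : ∏ i : Fin n, ((B i i / 2)! : ℝ) =
      ∏ i : Fin n, ∏ j : Fin n, if i = j then ((B i j / 2)! : ℝ) else 1 := by simp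
  simp only [multigraphWeight, Fintype.prod_prod_type, nonloop, hdiag, ← prod_pow_eq_pow_sum,
    ← prod_mul_distrib, ← prod_div_distrib]
  refine prod_congr rfl fun i _ => prod_congr rfl fun j _ => ?_
  rcases lt_trichotomy i j with h | rfl | h
  · simp [entryWeight, h, h.ne]
  · simp [entryWeight]
  · simp [entryWeight, h.not_gt, h.ne']

theorem multigraphWeight_add_edge {n : ℕ} {B : Fin n → Fin n → ℕ} (hsymm : ∀ i j, B i j = B j i)
    (heven : ∀ i, Even (B i i)) (a b : Fin n) :
    multigraphWeight (fun i j => B i j + edgeMat a b i j) * (B a b + edgeMat a b a b : ℕ) =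
      2 * multigraphWeight B := by
  wlog hab : a ≤ b generalizing a b with H
  · have := H b a (le_of_not_ge hab)
    rw [edgeMat_comm a b, hsymm a b]
    convert this using 3
    simp [edgeMat, and_comm, add_comm]
  unfold multigraphWeight
  rcases hab.lt_or_eq with hlt | rfl
  · rw [prod_eq_prod_mul_of_single (g := fun p => entryWeight p.1 p.2 (B p.1 p.2)) (a, b)
      (c := 2 / (B a b + 1))]
    · have : (B a b : ℝ) + 1 ≠ 0 := by positivity
      simp only [edgeMat, hlt.ne, hlt.ne', and_self, if_true, if_false, add_zero]
      push_cast
      field_simp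
    · rintro ⟨i, j⟩ hij
      by_cases h : i < j
      · have h1 : ¬(i = a ∧ j = b) := by
          rintro ⟨rfl, rfl⟩
          exact hij rfl
        have h2 : ¬(i = b ∧ j = a) := by
          rintro ⟨rfl, rfl⟩
          exact h.not_gt hlt
        simp [edgeMat, h1, h2]
      · by_cases hd : i = j
        · subst hd
          have h1 : ¬(i = a ∧ i = b) := by
            rintro ⟨rfl, rfl⟩
            exact hlt.false
          have h2 : ¬(i = b ∧ i = a) := fun h => h1 h.symm
          simp [edgeMat, h1, h2]
        · simp [entryWeight, h, hd]
    · simp only [edgeMat, entryWeight, hlt, hlt.ne, hlt.ne', and_self, if_true, if_false, add_zero]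
      rw [pow_succ, factorial_succ]
      push_cast
      field_simp
  · obtain ⟨k, hk⟩ := heven a
    have hk2 : (k + k) / 2 = k := by omega
    have hk3 : (k + k + (1 + 1)) / 2 = k + 1 := by omega
    rw [prod_eq_prod_mul_of_single (g := fun p => entryWeight p.1 p.2 (B p.1 p.2)) (a, a)
      (c := 1 / (k + 1))]
    · have : (k : ℝ) + 1 ≠ 0 := by positivity
      simp only [edgeMat, and_self, if_true, hk]
      push_cast
      field_simp
      ring
    · rintro ⟨i, j⟩ hij
      have h : ¬(i = a ∧ j = a) := by
        rintro ⟨rfl, rfl⟩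
        exact hij rfl
      simp [edgeMat, h]
    · simp only [edgeMat, entryWeight, lt_irrefl, and_self, if_true, if_false, hk, hk2, hk3]
      rw [factorial_succ]
      push_cast
      field_simp

theorem edgeMat_symm {n : ℕ} (a b i j : Fin n) : edgeMat a b i j = edgeMat a b j i := by
  simp only [edgeMat, add_comm (ite (i = a ∧ j = b) 1 0), and_comm]

theorem even_edgeMat_diag {n : ℕ} (a b i : Fin n) : Even (edgeMat a b i i) :=
  ⟨if i = a ∧ i = b then 1 else 0, by simp only [edgeMat, and_comm]⟩

theorem sum_edgeMat {n : ℕ} (a b : Fin n) : ∑ i, ∑ j, edgeMat a b i j = 2 := by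
  simp [edgeMat, sum_add_distrib, ite_and]

theorem card_edge_sequences {n : ℕ} (m : ℕ) {B : Fin n → Fin n → ℕ}
    (hsymm : ∀ i j, B i j = B j i) (heven : ∀ i, Even (B i i))
    (hsum : ∑ i, ∑ j, B i j = 2 * m) :
    (∑ σ : Fin m → Fin n × Fin n,
      if (fun i j => ∑ e, edgeMat (σ e).1 (σ e).2 i j) = B then (1 : ℝ) else 0) =
      m ! * multigraphWeight B := by
  induction m generalizing B with
  | zero =>
    have hB : B = fun _ _ => 0 := by
      ext i j
      simp only [mul_zero, sum_eq_zero_iff, mem_univ, true_imp_iff] at hsum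
      exact hsum i j
    subst hB
    simp [multigraphWeight, entryWeight]
  | succ m ih =>
    rw [← (Fin.consEquiv fun _ => Fin n × Fin n).sum_comp, Fintype.sum_prod_type]
    have key : ∀ p : Fin n × Fin n, (∑ σ : Fin m → Fin n × Fin n,
        if (fun i j => edgeMat p.1 p.2 i j + ∑ e, edgeMat (σ e).1 (σ e).2 i j) = B
          then (1 : ℝ) else 0) = m ! * multigraphWeight B * B p.1 p.2 / 2 := by
      rintro ⟨a, b⟩
      by_cases hab : B a b = 0
      · simp only [hab, Nat.cast_zero, mul_zero, zero_div]
        refine sum_eq_zero fun σ _ => if_neg fun h => ?_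
        have := congrFun (congrFun h a) b
        simp [edgeMat, hab] at this
      · have hle : ∀ i j, edgeMat a b i j ≤ B i j := by
          intro i j
          have hba := hsymm a b
          by_cases h : a = b
          · subst h
            obtain ⟨k, hk⟩ := heven a
            by_cases h' : i = a ∧ j = a
            · obtain ⟨rfl, rfl⟩ := h'
              simp only [edgeMat, and_self, if_true]
              omega
            · simp [edgeMat, h']
          · by_cases h1 : i = a ∧ j = b
            · obtain ⟨rfl, rfl⟩ := h1
              simp only [edgeMat, and_self, if_true, h, if_false, false_and]
              omega
            · by_cases h2 : i = b ∧ j = a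
              · obtain ⟨rfl, rfl⟩ := h2
                simp only [edgeMat, and_self, if_true, h1, if_false]
                omega
              · simp [edgeMat, h1, h2]
        obtain ⟨C, hC⟩ : ∃ C : Fin n → Fin n → ℕ, B = fun i j => C i j + edgeMat a b i j :=
          ⟨fun i j => B i j - edgeMat a b i j, by
            ext i j
            exact (Nat.sub_add_cancel (hle i j)).symm⟩
        have hCe : ∀ i j, B i j = C i j + edgeMat a b i j := fun i j => by rw [hC]
        have hCsymm : ∀ i j, C i j = C j i := by
          intro i j
          have h1 := hCe i j
          have h2 := hCe j i
          rw [edgeMat_symm, hsymm] at h1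
          omega
        have hCeven : ∀ i, Even (C i i) := by
          intro i
          have h := heven i
          rw [hCe, Nat.even_add] at h
          exact h.2 (even_edgeMat_diag a b i)
        have hCsum : ∑ i, ∑ j, C i j = 2 * m := by
          simp only [hCe, sum_add_distrib, sum_edgeMat] at hsum
          omega
        have hW := multigraphWeight_add_edge hCsymm hCeven a b
        rw [← hC, ← hCe] at hW
        rw [mul_assoc, hW, mul_left_comm, mul_div_cancel_left₀ _ two_ne_zero,
          ← ih hCsymm hCeven hCsum]
        refine sum_congr rfl fun σ _ => ?_
        congr 1
        simp only [hC, funext_iff, add_comm (edgeMat a b _ _), Nat.add_right_cancel_iff]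
    have hsum' : ∑ p : Fin n × Fin n, (B p.1 p.2 : ℝ) = 2 * (m + 1) := by
      rw [Fintype.sum_prod_type]
      exact_mod_cast hsum
    simp only [Fin.consEquiv, Equiv.coe_fn_mk, Fin.sum_univ_succ, Fin.cons_zero, Fin.cons_succ]
    rw [sum_congr rfl fun p _ => key p, ← sum_div, ← mul_sum, hsum', factorial_succ]
    push_cast
    ring

/-- Grouping the stubs `2e`, `2e + 1` into the edge `e`. -/
def stubPairEquiv (m : ℕ) (α : Type*) : (Fin (2 * m) → α) ≃ (Fin m → α × α) where
  toFun ψ e := (ψ ⟨2 * (e : ℕ), by omega⟩, ψ ⟨2 * (e : ℕ) + 1, by omega⟩)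
  invFun σ l := if (l : ℕ) % 2 = 0 then (σ ⟨l / 2, by omega⟩).1 else (σ ⟨l / 2, by omega⟩).2
  left_inv ψ := by
    ext l
    obtain ⟨e, rfl | rfl⟩ := exists_edge_eq l
    · simp
    · have h : (2 * (e : ℕ) + 1) / 2 = e := by omega
      simp [h]
  right_inv σ := by
    ext e
    · simp
    · have h : (2 * (e : ℕ) + 1) / 2 = e := by omega
      simp [h]

theorem card_stubAdj_fiber {n m : ℕ} {B : Fin n → Fin n → ℕ} (hB : B ∈ stateSpace n m) :
    ((univ.filter fun ψ : Fin (2 * m) → Fin n => (fun i j => stubAdj ψ i j) = B).card : ℝ) =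
      m ! * multigraphWeight B := by
  obtain ⟨ξ, -, rfl⟩ := mem_image.1 hB
  rw [← card_edge_sequences m]
  · rw [← (stubPairEquiv m (Fin n)).sum_comp, card_filter]
    push_cast
    simp only [stubAdj_eq_sum_edgeMat]
    rfl
  · intro i j
    simp only [stubAdj_eq_sum_edgeMat, edgeMat_symm _ _ i j]
  · intro i
    simp only [stubAdj_eq_sum_edgeMat]
    exact Finset.even_sum _ fun e _ => even_edgeMat_diag _ _ _
  · exact (sum_congr rfl fun i _ => degB_stubAdj ξ i).trans (sum_colorCount ξ)

theorem pagDist_eq (κ : ℝ) {n m : ℕ} {B : Fin n → Fin n → ℕ} (hB : B ∈ stateSpace n m) :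
    pagDist κ n m B =
      ((∏ i : Fin n, ∏ j ∈ Finset.range (degB B i), (κ + j)) /
          ∏ j ∈ Finset.range (2 * m), (κ * n + j)) * (m ! * multigraphWeight B) := by
  rw [← card_stubAdj_fiber hB, mul_comm, ← nsmul_eq_mul, pagDist]
  refine sum_eq_card_nsmul fun ψ hψ => ?_
  obtain rfl := (mem_filter.1 hψ).2
  simp only [degB_stubAdj, polyaProb]

/-- The distribution of `PAG_κ(n,m)` assigns to each `B ∈ A_n^m` the
probability `(∏_i ∏_{j=1}^{d(B,i)}(κ+j−1))/(∏_{j=1}^{2m}(κn+j−1)) ·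
m!·2^{m'(B)}/((∏_{i<j}B(i,j)!)·(∏_i (B(i,i)/2)!))`; it is a stationary distribution of
the edge reconnecting Markov chain with parameter `κ`, and it is the unique such
distribution. -/
theorem edge_reconnecting_stationary (κ : ℝ) (hκ : 0 < κ) (n m : ℕ)
    (hn : 0 < n) (hm : 0 < m) :
    (∀ B ∈ stateSpace n m,
      pagDist κ n m B =
        ((∏ i : Fin n, ∏ j ∈ Finset.range (degB B i), (κ + j)) /
            ∏ j ∈ Finset.range (2 * m), (κ * n + j)) *
          ((m ! : ℝ) * 2 ^ nonloop B /
            ((∏ i : Fin n, ∏ j : Fin n, if i < j then ((B i j)! : ℝ) else 1) *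
              ∏ i : Fin n, ((B i i / 2)! : ℝ)))) ∧
    (∀ B' ∈ stateSpace n m,
      ∑ B ∈ stateSpace n m, pagDist κ n m B * reconnectKernel κ n m B B' =
        pagDist κ n m B') ∧
    (∀ p : (Fin n → Fin n → ℕ) → ℝ,
      (∀ B, 0 ≤ p B) → (∑ B ∈ stateSpace n m, p B = 1) →
      (∀ B' ∈ stateSpace n m,
        ∑ B ∈ stateSpace n m, p B * reconnectKernel κ n m B B' = p B') →
      ∀ B ∈ stateSpace n m, p B = pagDist κ n m B) := by
  refine ⟨fun B hB => ?_, fun B' hB' => pagDist_stationary hκ hn hm hB',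
    fun p _ hsum hp B hB => eq_pagDist_of_stationary hκ hn hm hsum hp hB⟩
  rw [pagDist_eq κ hB, multigraphWeight_eq, mul_div_assoc]
end

section
/- Let X_n be vertex exchangeable random elements of A_n with X_n^{[k]} → X_W^{[k]} in distribution for all k (for some multigraphon W). Then for every k ∈ ℕ and A ∈ A_k, lim_n E[t_=(A, X_n)²] = t_=(A,W)², and consequently Var(t_=(A, X_n)) → 0. -/
open Finset MeasureTheory Filter

/-- The uniform distribution on `[0,1]`. -/
noncomputable def unifI : Measure ℝ := volume.restrict (Set.Icc 0 1)

/-- The induced homomorphism density `t_=(A,B) = n^{-k} ∑_{φ:[k]→[n]} 1[A = B∘(φ×φ)]`. -/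
noncomputable def tind {k n : ℕ} (A : Fin k → Fin k → ℕ) (B : Fin n → Fin n → ℕ) : ℝ :=
  (∑ φ : Fin k → Fin n,
      if ∀ i j, A i j = B (φ i) (φ j) then (1:ℝ) else 0) / (n : ℝ) ^ k

/-- The induced homomorphism density of `A` in a multigraphon `W`:
`t_=(A,W) = ∫_{[0,1]^k} ∏_{i≤j} W(x_i,x_j,A(i,j)) dx`. -/
noncomputable def tindW {k : ℕ} (A : Fin k → Fin k → ℕ) (W : ℝ → ℝ → ℕ → ℝ) : ℝ :=
  ∫ x : Fin k → ℝ,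
    ∏ i : Fin k, ∏ j : Fin k, (if i ≤ j then W (x i) (x j) (A i j) else 1)
    ∂ (Measure.pi fun _ : Fin k => unifI)

/-- `X^{[k]} = A`: the top-left `k × k` corner of `B` equals `A`. -/
def cornerEq {n k : ℕ} (B : Fin n → Fin n → ℕ) (A : Fin k → Fin k → ℕ) : Prop :=
  ∀ (i j : Fin k) (hi : (i : ℕ) < n) (hj : (j : ℕ) < n), B ⟨i, hi⟩ ⟨j, hj⟩ = A i j

lemma ENNReal.tsum_fin_prod {n : ℕ} (f : Fin n → ℕ → ENNReal) :
    ∑' C : Fin n → ℕ, ∏ i, f i (C i) = ∏ i, ∑' c, f i c := by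
  induction n with
  | zero => simp
  | succ n ih =>
    rw [← (Fin.consEquiv fun _ : Fin (n + 1) => ℕ).tsum_eq, ENNReal.tsum_prod']
    simp only [Fin.consEquiv_apply, Fin.prod_univ_succ, Fin.cons_zero, Fin.cons_succ,
      ENNReal.tsum_mul_left, ENNReal.tsum_mul_right, ih]

/-- A product of series indexed by a finite type, expanded over all choice functions. -/
lemma ENNReal.tsum_fintype_prod {ι : Type*} [Fintype ι] (f : ι → ℕ → ENNReal) :
    ∑' C : ι → ℕ, ∏ i, f i (C i) = ∏ i, ∑' c, f i c := by
  let e := Fintype.equivFin ι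
  rw [← (Equiv.arrowCongr e.symm (Equiv.refl ℕ)).tsum_eq,
    ← e.symm.prod_comp fun i => ∑' c, f i c, ← ENNReal.tsum_fin_prod]
  refine tsum_congr fun C => ?_
  rw [← e.symm.prod_comp]
  simp

/-- Fatou's lemma for pointwise convergent measures on a countable space. -/
lemma tsum_indicator_le_liminf_measure {ι : Type*} [Countable ι] [MeasurableSpace ι]
    [MeasurableSingletonClass ι] (ν : ℕ → Measure ι) (f : ι → ENNReal)
    (hf : ∀ i, Tendsto (fun n => ν n {i}) atTop (nhds (f i))) (S : Set ι) :
    ∑' i, S.indicator f i ≤ liminf (fun n => ν n S) atTop := by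
  have h := lintegral_liminf_le (μ := Measure.count) (u := atTop)
    (f := fun (n : ℕ) (i : ι) => S.indicator (fun i => ν n {i}) i)
    fun n => measurable_of_countable _
  simp only [lintegral_count, Measure.tsum_indicator_apply_singleton _ _ S.to_countable.measurableSet]
    at h
  refine le_trans (le_of_eq (tsum_congr fun i => ?_)) h
  by_cases hi : i ∈ S <;> simp [hi, (hf _).liminf_eq]

/-- Scheffé's lemma on a countable space. -/
lemma tendsto_measure_of_tendsto_singleton {ι : Type*} [Countable ι] [MeasurableSpace ι]
    [MeasurableSingletonClass ι] (ν : ℕ → Measure ι) [∀ n, IsProbabilityMeasure (ν n)]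
    (f : ι → ENNReal) (hf : ∀ i, Tendsto (fun n => ν n {i}) atTop (nhds (f i)))
    (hf_sum : ∑' i, f i = 1) (S : Set ι) :
    Tendsto (fun n => ν n S) atTop (nhds (∑' i, S.indicator f i)) := by
  refine tendsto_of_le_liminf_of_limsup_le (tsum_indicator_le_liminf_measure ν f hf S) ?_
  have hcompl : ∀ n, ν n S = 1 - ν n Sᶜ := fun n => by
    rw [← prob_compl_eq_one_sub Sᶜ.to_countable.measurableSet, compl_compl]
  simp_rw [hcompl]
  rw [ENNReal.limsup_const_sub _ _ ENNReal.one_ne_top]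
  refine (tsub_le_tsub_left (tsum_indicator_le_liminf_measure ν f hf Sᶜ) 1).trans ?_
  rw [tsub_le_iff_right, ← ENNReal.tsum_add, ← hf_sum]
  refine (tsum_congr fun i => ?_).le
  exact (congrFun (Set.indicator_self_add_compl S f) i).symm

instance : IsProbabilityMeasure unifI := ⟨by simp [unifI]⟩

lemma ae_pi_unifI_mem_Icc (m : ℕ) :
    ∀ᵐ x ∂(Measure.pi fun _ : Fin m => unifI), ∀ i, x i ∈ Set.Icc (0 : ℝ) 1 := by
  rw [ae_all_iff]
  intro i
  exact (Measure.quasiMeasurePreserving_eval (fun _ : Fin m => unifI) i).ae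
    (ae_restrict_mem measurableSet_Icc)

lemma measurePreserving_append {α : Type*} [MeasurableSpace α] (ν : Measure α) [SigmaFinite ν]
    (k l : ℕ) :
    MeasurePreserving (fun p : (Fin k → α) × (Fin l → α) => Fin.append p.1 p.2)
      ((Measure.pi fun _ => ν).prod (Measure.pi fun _ => ν))
      (Measure.pi fun _ : Fin (k + l) => ν) := by
  have hmeas : Measurable fun p : (Fin k → α) × (Fin l → α) => Fin.append p.1 p.2 := by
    rw [measurable_pi_iff]
    intro i
    refine Fin.addCases (fun i => ?_) (fun i => ?_) i <;> simp <;> fun_prop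
  refine ⟨hmeas, (Measure.pi_eq fun s hs => ?_).symm⟩
  rw [Measure.map_apply hmeas (MeasurableSet.univ_pi hs)]
  have : (fun p : (Fin k → α) × (Fin l → α) => Fin.append p.1 p.2) ⁻¹' Set.univ.pi s =
      (Set.univ.pi fun i => s (Fin.castAdd l i)) ×ˢ (Set.univ.pi fun i => s (Fin.natAdd k i)) := by
    ext p
    simp [Set.mem_pi, Fin.forall_fin_add]
  rw [this, Measure.prod_prod, Measure.pi_pi, Measure.pi_pi, Fin.prod_univ_add]

lemma tendsto_descFactorial_div_pow (m : ℕ) :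
    Tendsto (fun n : ℕ => (n.descFactorial m : ℝ) / (n : ℝ) ^ m) atTop (nhds 1) := by
  have h : ∀ i ∈ range m, Tendsto (fun n : ℕ => ((n - i : ℕ) : ℝ) / n) atTop (nhds 1) := by
    intro i _
    have h0 : Tendsto (fun n : ℕ => 1 - (i : ℝ) / n) atTop (nhds 1) := by
      simpa using (tendsto_const_div_atTop_nhds_zero_nat (i : ℝ)).const_sub 1
    refine h0.congr' ?_
    filter_upwards [eventually_ge_atTop (i + 1)] with n hn
    rw [Nat.cast_sub (by omega), sub_div, div_self]
    have : 0 < n := by omega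
    positivity
  have := tendsto_finsetProd _ h
  simp only [prod_const_one] at this
  refine this.congr fun n => ?_
  rw [prod_div_distrib, prod_const, card_range, Nat.descFactorial_eq_prod_range]
  push_cast
  rfl

lemma card_injective_fin (m n : ℕ) :
    #{χ : Fin m → Fin n | Function.Injective χ} = n.descFactorial m := by
  classical
  rw [← Fintype.card_subtype, Fintype.card_congr (Equiv.subtypeInjectiveEquivEmbedding _ _),
    Fintype.card_embedding_eq, Fintype.card_fin, Fintype.card_fin]

/-- For a vertex exchangeable random array, the expected density of a property of `m`-vertex
samples differs from its probability on the first `m` vertices by at most the proportion of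
non-injective samples. -/
lemma abs_integral_density_sub_le {Ω : Type*} [MeasurableSpace Ω] (μ : Measure Ω)
    [IsProbabilityMeasure μ] {m n : ℕ} (hmn : m ≤ n) (hn : 0 < n) (X : Ω → Fin n → Fin n → ℕ)
    (hX : Measurable X)
    (hexch : ∀ τ : Equiv.Perm (Fin n),
      Measure.map (fun ω => fun i j => X ω (τ i) (τ j)) μ = Measure.map X μ)
    (Q : (Fin m → Fin m → ℕ) → Prop) [DecidablePred Q] :
    |(∫ ω, (∑ χ : Fin m → Fin n, if Q fun i j => X ω (χ i) (χ j) then (1 : ℝ) else 0) /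
        (n : ℝ) ^ m ∂μ) -
      μ.real {ω | Q fun i j => X ω (Fin.castLE hmn i) (Fin.castLE hmn j)}| ≤
      1 - (n.descFactorial m : ℝ) / (n : ℝ) ^ m := by
  classical
  set q := μ.real {ω | Q fun i j => X ω (Fin.castLE hmn i) (Fin.castLE hmn j)} with hq
  have hset : ∀ χ : Fin m → Fin n, MeasurableSet {ω | Q fun i j => X ω (χ i) (χ j)} := fun χ =>
    hX (Set.to_countable {B : Fin n → Fin n → ℕ | Q fun i j => B (χ i) (χ j)}).measurableSet
  have hind : ∀ χ : Fin m → Fin n,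
      (fun ω => if Q fun i j => X ω (χ i) (χ j) then (1 : ℝ) else 0) =
        {ω | Q fun i j => X ω (χ i) (χ j)}.indicator 1 := fun χ => by
    ext ω
    simp [Set.indicator_apply]
  have hint : ∀ χ : Fin m → Fin n,
      ∫ ω, (if Q fun i j => X ω (χ i) (χ j) then (1 : ℝ) else 0) ∂μ =
        μ.real {ω | Q fun i j => X ω (χ i) (χ j)} := fun χ => by
    rw [← integral_indicator_one (hset χ), hind]
  have hinj : ∀ χ : Fin m → Fin n, Function.Injective χ →
      μ.real {ω | Q fun i j => X ω (χ i) (χ j)} = q := by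
    intro χ hχ
    obtain ⟨τ, hτ⟩ := Equiv.Perm.exists_extending_pair (Fin.castLE hmn) χ
      (Fin.castLE_injective hmn) hχ
    have hτX : Measurable fun ω => fun i j => X ω (τ i) (τ j) := by fun_prop
    have h := congrArg
      (fun ν => ν {B | Q fun i j => B (Fin.castLE hmn i) (Fin.castLE hmn j)}) (hexch τ)
    simp only [Measure.map_apply hτX (Set.to_countable _).measurableSet,
      Measure.map_apply hX (Set.to_countable _).measurableSet, Set.preimage_ofPred_eq, hτ] at h
    simp only [hq, Measure.real, h]
  have hnm : (0 : ℝ) < (n : ℝ) ^ m := by positivity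
  have hcard : ∑ _χ : Fin m → Fin n, (1 : ℝ) = (n : ℝ) ^ m := by simp
  have hmean : (∫ ω, (∑ χ : Fin m → Fin n, if Q fun i j => X ω (χ i) (χ j) then (1 : ℝ) else 0) /
      (n : ℝ) ^ m ∂μ) - q =
      (∑ χ : Fin m → Fin n, (μ.real {ω | Q fun i j => X ω (χ i) (χ j)} - q)) / (n : ℝ) ^ m := by
    rw [integral_div, integral_finsetSum _ fun χ _ => ?_]
    · simp_rw [hint]
      rw [sum_sub_distrib, sub_div]
      simp
      field_simp
    · rw [hind]
      exact (integrable_const (1 : ℝ)).indicator (hset χ)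
  rw [hmean, abs_div, abs_of_pos hnm, ← div_self hnm.ne', ← sub_div]
  gcongr
  refine (abs_sum_le_sum_abs _ _).trans ?_
  have hbound : ∀ χ : Fin m → Fin n, |μ.real {ω | Q fun i j => X ω (χ i) (χ j)} - q| ≤
      1 - if Function.Injective χ then 1 else 0 := by
    intro χ
    split_ifs with hχ
    · simp [hinj χ hχ]
    · have h1 : ∀ s : Set Ω, 0 ≤ μ.real s ∧ μ.real s ≤ 1 := fun s =>
        ⟨measureReal_nonneg, measureReal_le_one⟩
      rw [abs_le]
      constructor <;>
        linarith [h1 {ω | Q fun i j => X ω (χ i) (χ j)},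
          h1 {ω | Q fun i j => X ω (Fin.castLE hmn i) (Fin.castLE hmn j)}]
  refine (sum_le_sum fun χ _ => hbound χ).trans_eq ?_
  rw [sum_sub_distrib, hcard, sum_boole, card_injective_fin]

lemma tind_sq {k n : ℕ} (A : Fin k → Fin k → ℕ) (B : Fin n → Fin n → ℕ) :
    tind A B ^ 2 =
      (∑ χ : Fin (k + k) → Fin n,
        if (∀ i j, A i j = B (χ (Fin.castAdd k i)) (χ (Fin.castAdd k j))) ∧
          ∀ i j, A i j = B (χ (Fin.natAdd k i)) (χ (Fin.natAdd k j)) then (1 : ℝ) else 0) /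
        (n : ℝ) ^ (k + k) := by
  rw [tind, div_pow, ← pow_mul, mul_two, sq, Fintype.sum_mul_sum, ← Fintype.sum_prod_type',
    ← (Fin.appendEquiv k k).sum_comp]
  congr 1
  refine Fintype.sum_congr _ _ fun p => ?_
  simp only [Fin.appendEquiv, Equiv.coe_fn_mk, Fin.append_left, Fin.append_right,
    ite_zero_mul_ite_zero, one_mul]

/-- The conditions on a multigraphon, apart from its symmetry. -/
structure IsMultigraphon (W : ℝ → ℝ → ℕ → ℝ) : Prop where
  measurable : ∀ c, Measurable fun p : ℝ × ℝ => W p.1 p.2 c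
  nonneg : ∀ x y c, 0 ≤ W x y c
  tsum_eq_one : ∀ x ∈ Set.Icc (0 : ℝ) 1, ∀ y ∈ Set.Icc (0 : ℝ) 1, ∑' c : ℕ, W x y c = 1
  diag_odd : ∀ x ∈ Set.Icc (0 : ℝ) 1, ∀ c : ℕ, W x x (2 * c + 1) = 0

namespace IsMultigraphon

variable {W : ℝ → ℝ → ℕ → ℝ}

lemma tsum_ofReal (hW : IsMultigraphon W) {x y : ℝ} (hx : x ∈ Set.Icc (0 : ℝ) 1)
    (hy : y ∈ Set.Icc (0 : ℝ) 1) : ∑' c, ENNReal.ofReal (W x y c) = 1 := by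
  have hsum : Summable (W x y) := by
    by_contra h
    simpa [tsum_eq_zero_of_not_summable h] using hW.tsum_eq_one x hx y hy
  rw [← ENNReal.ofReal_tsum_of_nonneg (hW.nonneg x y) hsum, hW.tsum_eq_one x hx y hy,
    ENNReal.ofReal_one]

lemma ofReal_le_one (hW : IsMultigraphon W) {x y : ℝ} (hx : x ∈ Set.Icc (0 : ℝ) 1)
    (hy : y ∈ Set.Icc (0 : ℝ) 1) (c : ℕ) : ENNReal.ofReal (W x y c) ≤ 1 :=
  (ENNReal.le_tsum c).trans_eq (hW.tsum_ofReal hx hy)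

lemma measurable_eval (hW : IsMultigraphon W) {m : ℕ} (i j : Fin m) (c : ℕ) :
    Measurable fun x : Fin m → ℝ => W (x i) (x j) c :=
  (hW.measurable c).comp
    (f := fun x : Fin m → ℝ => (x i, x j)) ((measurable_pi_apply i).prodMk (measurable_pi_apply j))

lemma measurable_ofReal (hW : IsMultigraphon W) {m : ℕ} (i j : Fin m) (c : ℕ) :
    Measurable fun x : Fin m → ℝ => ENNReal.ofReal (W (x i) (x j) c) :=
  (hW.measurable_eval i j c).ennreal_ofReal

lemma ofReal_tindW (hW : IsMultigraphon W) {m : ℕ} (A : Fin m → Fin m → ℕ) :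
    ENNReal.ofReal (tindW A W) =
      ∫⁻ x : Fin m → ℝ, ∏ i, ∏ j,
        (if i ≤ j then ENNReal.ofReal (W (x i) (x j) (A i j)) else 1)
      ∂(Measure.pi fun _ : Fin m => unifI) := by
  have hmeas : Measurable fun x : Fin m → ℝ =>
      ∏ i : Fin m, ∏ j : Fin m, (if i ≤ j then W (x i) (x j) (A i j) else 1) := by
    refine Finset.measurable_prod _ fun i _ => Finset.measurable_prod _ fun j _ => ?_
    split_ifs
    · exact hW.measurable_eval i j _
    · exact measurable_const
  have hnn : ∀ (x : Fin m → ℝ) (i j : Fin m),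
      0 ≤ if i ≤ j then W (x i) (x j) (A i j) else 1 := fun x i j => by
    split_ifs
    exacts [hW.nonneg _ _ _, zero_le_one]
  have hofReal : ∀ x : Fin m → ℝ, ENNReal.ofReal
      (∏ i : Fin m, ∏ j : Fin m, (if i ≤ j then W (x i) (x j) (A i j) else 1)) =
      ∏ i, ∏ j, (if i ≤ j then ENNReal.ofReal (W (x i) (x j) (A i j)) else 1) := fun x => by
    rw [ENNReal.ofReal_prod_of_nonneg fun i _ => prod_nonneg fun j _ => hnn x i j]
    refine prod_congr rfl fun i _ => ?_
    rw [ENNReal.ofReal_prod_of_nonneg fun j _ => hnn x i j]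
    refine prod_congr rfl fun j _ => ?_
    split_ifs <;> simp
  rw [tindW, integral_eq_lintegral_of_nonneg_ae
    (ae_of_all _ fun x => prod_nonneg fun i _ => prod_nonneg fun j _ => hnn x i j)
    hmeas.aestronglyMeasurable]
  simp_rw [hofReal]
  refine ENNReal.ofReal_toReal (ne_top_of_le_ne_top ENNReal.one_ne_top ?_)
  have hle : ∀ᵐ x ∂(Measure.pi fun _ : Fin m => unifI),
      ∏ i, ∏ j, (if i ≤ j then ENNReal.ofReal (W (x i) (x j) (A i j)) else 1) ≤ 1 := by
    filter_upwards [ae_pi_unifI_mem_Icc m] with x hx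
    refine prod_le_one' fun i _ => prod_le_one' fun j _ => ?_
    split_ifs
    exacts [hW.ofReal_le_one (hx i) (hx j) _, le_rfl]
  exact (lintegral_mono_ae hle).trans_eq (by simp)

end IsMultigraphon

/-- The conditional probability, given the vertex labels `x`, that the entry `e` of the upper
triangle of a `W`-random array is `c`; entries below the diagonal are set to `0`. -/
noncomputable def pairWeight (W : ℝ → ℝ → ℕ → ℝ) {m : ℕ} (x : Fin m → ℝ) (e : Fin m × Fin m)
    (c : ℕ) : ENNReal :=
  if e.1 ≤ e.2 then ENNReal.ofReal (W (x e.1) (x e.2) c) else if c = 0 then 1 else 0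

/-- The upper triangle of the top-left `m × m` corner of `B`, padded with zeros. -/
def upperCorner {n : ℕ} (m : ℕ) (B : Fin n → Fin n → ℕ) (e : Fin m × Fin m) : ℕ :=
  if h : e.1 ≤ e.2 ∧ (e.1 : ℕ) < n ∧ (e.2 : ℕ) < n then B ⟨e.1, h.2.1⟩ ⟨e.2, h.2.2⟩ else 0

section

variable {W : ℝ → ℝ → ℕ → ℝ} {m : ℕ}

lemma measurable_pairWeight (hW : IsMultigraphon W) (e : Fin m × Fin m) (c : ℕ) :
    Measurable fun x => pairWeight W x e c := by
  unfold pairWeight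
  split_ifs
  exacts [hW.measurable_ofReal _ _ _, measurable_const, measurable_const]

lemma tsum_pairWeight (hW : IsMultigraphon W) {x : Fin m → ℝ}
    (hx : ∀ i, x i ∈ Set.Icc (0 : ℝ) 1) (e : Fin m × Fin m) : ∑' c, pairWeight W x e c = 1 := by
  unfold pairWeight
  split_ifs
  exacts [hW.tsum_ofReal (hx _) (hx _), tsum_ite_eq 0 1]

lemma tsum_indicator_lintegral_prod_pairWeight (hW : IsMultigraphon W)
    (P : Fin m × Fin m → ℕ → Prop) [∀ e c, Decidable (P e c)] :
    ∑' C : Fin m × Fin m → ℕ, {C : Fin m × Fin m → ℕ | ∀ e, P e (C e)}.indicator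
        (fun C => ∫⁻ x, ∏ e, pairWeight W x e (C e) ∂(Measure.pi fun _ : Fin m => unifI)) C =
      ∫⁻ x, ∏ e : Fin m × Fin m, ∑' c, (if P e c then pairWeight W x e c else 0)
        ∂(Measure.pi fun _ : Fin m => unifI) := by
  simp_rw [← ENNReal.tsum_fintype_prod]
  rw [lintegral_tsum]
  · refine tsum_congr fun C => ?_
    by_cases hC : ∀ e, P e (C e)
    · simp [hC]
    · obtain ⟨e, he⟩ := not_forall.1 hC
      have h0 : ∀ x : Fin m → ℝ, ∏ e, (if P e (C e) then pairWeight W x e (C e) else 0) = 0 :=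
        fun x => prod_eq_zero (mem_univ e) (if_neg he)
      rw [Set.indicator_of_notMem (by exact hC)]
      simp [h0]
  · refine fun C => (Finset.measurable_prod _ fun e _ => ?_).aemeasurable
    split_ifs
    exacts [measurable_pairWeight hW e _, measurable_const]

lemma tendsto_measure_upperCorner_eq (hW : IsMultigraphon W)
    {Ω : ℕ → Type*} [∀ n, MeasurableSpace (Ω n)] (μ : ∀ n, Measure (Ω n))
    [∀ n, IsProbabilityMeasure (μ n)] (X : ∀ n, Ω n → Fin n → Fin n → ℕ)
    (hA : ∀ n ω, (∀ i j, X n ω i j = X n ω j i) ∧ ∀ i, 2 ∣ X n ω i i)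
    (hconv : ∀ A : Fin m → Fin m → ℕ, (∀ i j, A i j = A j i) → (∀ i, 2 ∣ A i i) →
        Tendsto (fun n => ((μ n) {ω | cornerEq (X n ω) A}).toReal) atTop (nhds (tindW A W)))
    (C : Fin m × Fin m → ℕ) :
    Tendsto (fun n => μ n {ω | upperCorner m (X n ω) = C}) atTop
      (nhds (∫⁻ x, ∏ e, pairWeight W x e (C e) ∂(Measure.pi fun _ : Fin m => unifI))) := by
  by_cases hlow : ∀ e : Fin m × Fin m, ¬ e.1 ≤ e.2 → C e = 0
  swap
  · push Not at hlow
    obtain ⟨e, he, hCe⟩ := hlow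
    have h0 : ∀ x : Fin m → ℝ, ∏ e, pairWeight W x e (C e) = 0 := fun x =>
      prod_eq_zero (mem_univ e) (by simp [pairWeight, he.not_ge, hCe])
    have hempty : ∀ n, {ω | upperCorner m (X n ω) = C} = ∅ := fun n => by
      ext ω
      simp only [Set.mem_ofPred_eq, Set.mem_empty_iff_false, iff_false]
      rintro rfl
      exact hCe (by simp [upperCorner, he.not_ge])
    simp [h0, hempty]
  by_cases hdiag : ∀ i, 2 ∣ C (i, i)
  swap
  · push Not at hdiag
    obtain ⟨i, hi⟩ := hdiag
    have h0 : ∀ᵐ x ∂(Measure.pi fun _ : Fin m => unifI),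
        ∏ e, pairWeight W x e (C e) = 0 := by
      filter_upwards [ae_pi_unifI_mem_Icc m] with x hx
      refine prod_eq_zero (mem_univ (i, i)) ?_
      have : C (i, i) = 2 * (C (i, i) / 2) + 1 := by omega
      simp only [pairWeight, le_refl, if_true]
      rw [this, hW.diag_odd _ (hx i), ENNReal.ofReal_zero]
    have hempty : ∀ n, {ω | upperCorner m (X n ω) = C} = ∅ := fun n => by
      ext ω
      simp only [Set.mem_ofPred_eq, Set.mem_empty_iff_false, iff_false]
      rintro rfl
      refine hi ?_
      unfold upperCorner
      split_ifs
      exacts [(hA n ω).2 _, dvd_zero 2]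
    simp [lintegral_congr_ae h0, hempty]
  set A : Fin m → Fin m → ℕ := fun i j => C (min i j, max i j) with hAdef
  have hlim := ENNReal.tendsto_ofReal (hconv A (fun i j => by simp [hAdef, min_comm, max_comm])
    fun i => by simpa [hAdef] using hdiag i)
  rw [hW.ofReal_tindW A] at hlim
  have hfC : ∀ x : Fin m → ℝ,
      ∏ i, ∏ j, (if i ≤ j then ENNReal.ofReal (W (x i) (x j) (A i j)) else 1) =
        ∏ e, pairWeight W x e (C e) := fun x => by
    rw [Fintype.prod_prod_type]
    refine prod_congr rfl fun i _ => prod_congr rfl fun j _ => ?_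
    unfold pairWeight
    split_ifs with h h'
    · simp [hAdef, h]
    · rfl
    · exact absurd (hlow (i, j) h) h'
  simp_rw [hfC] at hlim
  refine hlim.congr' ?_
  filter_upwards [eventually_ge_atTop m] with n hn
  rw [ENNReal.ofReal_toReal (measure_ne_top _ _)]
  congr 1
  ext ω
  simp only [Set.mem_ofPred_eq, cornerEq, funext_iff, Prod.forall]
  have hlt : ∀ i : Fin m, (i : ℕ) < n := fun i => i.2.trans_le hn
  constructor
  · intro h i j
    by_cases hij : i ≤ j
    · simpa [upperCorner, hij, hlt, hAdef] using h i j (hlt i) (hlt j)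
    · simp only [upperCorner, hij, false_and, dite_false]
      exact (hlow (i, j) hij).symm
  · intro h i j hi hj
    rcases le_total i j with hij | hij
    · simpa [upperCorner, hij, hlt, hAdef] using h i j
    · rw [(hA n ω).1]
      simpa [upperCorner, hij, hlt, hAdef] using h j i

/-- If the corners of `X n` converge in distribution to those of the `W`-random array, then the
probability of any event prescribing the allowed values of each entry converges. -/
lemma tendsto_measure_forall_upperCorner (hW : IsMultigraphon W)
    {Ω : ℕ → Type*} [∀ n, MeasurableSpace (Ω n)] (μ : ∀ n, Measure (Ω n))
    [∀ n, IsProbabilityMeasure (μ n)] (X : ∀ n, Ω n → Fin n → Fin n → ℕ)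
    (hX : ∀ n, Measurable (X n))
    (hA : ∀ n ω, (∀ i j, X n ω i j = X n ω j i) ∧ ∀ i, 2 ∣ X n ω i i)
    (hconv : ∀ A : Fin m → Fin m → ℕ, (∀ i j, A i j = A j i) → (∀ i, 2 ∣ A i i) →
        Tendsto (fun n => ((μ n) {ω | cornerEq (X n ω) A}).toReal) atTop (nhds (tindW A W)))
    (P : Fin m × Fin m → ℕ → Prop) [∀ e c, Decidable (P e c)] :
    Tendsto (fun n => μ n {ω | ∀ e, P e (upperCorner m (X n ω) e)}) atTop
      (nhds (∫⁻ x, ∏ e : Fin m × Fin m, ∑' c, (if P e c then pairWeight W x e c else 0)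
        ∂(Measure.pi fun _ : Fin m => unifI))) := by
  have hmeas : ∀ n, Measurable fun ω => upperCorner m (X n ω) := fun n =>
    (measurable_of_countable (upperCorner m)).comp (hX n)
  have : ∀ n, IsProbabilityMeasure ((μ n).map fun ω => upperCorner m (X n ω)) := fun n =>
    Measure.isProbabilityMeasure_map (hmeas n).aemeasurable
  have h := tendsto_measure_of_tendsto_singleton
    (fun n => (μ n).map fun ω => upperCorner m (X n ω))
    (fun C => ∫⁻ x, ∏ e, pairWeight W x e (C e) ∂(Measure.pi fun _ : Fin m => unifI))
    (fun C => ?_) ?_ {C | ∀ e, P e (C e)}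
  · rw [tsum_indicator_lintegral_prod_pairWeight hW] at h
    refine h.congr fun n => ?_
    rw [Measure.map_apply (hmeas n) (Set.to_countable _).measurableSet]
    rfl
  · refine (tendsto_measure_upperCorner_eq hW μ X hA hconv C).congr fun n => ?_
    rw [Measure.map_apply (hmeas n) (measurableSet_singleton _)]
    rfl
  · have hT := tsum_indicator_lintegral_prod_pairWeight hW (m := m) fun _ _ => True
    simp only [implies_true, Set.ofPred_true, Set.indicator_univ, if_true] at hT
    rw [hT]
    have h1 : ∀ᵐ x ∂(Measure.pi fun _ : Fin m => unifI),
        ∏ e : Fin m × Fin m, ∑' c, pairWeight W x e c = 1 := by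
      filter_upwards [ae_pi_unifI_mem_Icc m] with x hx
      exact prod_eq_one fun e _ => tsum_pairWeight hW hx e
    rw [lintegral_congr_ae h1]
    simp

end

/-- The probability that two disjoint `k`-vertex corners both equal `A` tends to the square of the
homomorphism density of `A` in the limit. -/
lemma tendsto_measure_two_corners {W : ℝ → ℝ → ℕ → ℝ} (hW : IsMultigraphon W)
    {Ω : ℕ → Type*} [∀ n, MeasurableSpace (Ω n)] (μ : ∀ n, Measure (Ω n))
    [∀ n, IsProbabilityMeasure (μ n)] (X : ∀ n, Ω n → Fin n → Fin n → ℕ)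
    (hX : ∀ n, Measurable (X n))
    (hA : ∀ n ω, (∀ i j, X n ω i j = X n ω j i) ∧ ∀ i, 2 ∣ X n ω i i)
    {k : ℕ}
    (hconv : ∀ B : Fin (k + k) → Fin (k + k) → ℕ, (∀ i j, B i j = B j i) → (∀ i, 2 ∣ B i i) →
        Tendsto (fun n => ((μ n) {ω | cornerEq (X n ω) B}).toReal) atTop (nhds (tindW B W)))
    (A : Fin k → Fin k → ℕ) (hsymA : ∀ i j, A i j = A j i) :
    Tendsto (fun n => μ n {ω | ∀ h : k + k ≤ n,
        (∀ i j, A i j = X n ω (Fin.castLE h (Fin.castAdd k i)) (Fin.castLE h (Fin.castAdd k j))) ∧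
        ∀ i j, A i j = X n ω (Fin.castLE h (Fin.natAdd k i)) (Fin.castLE h (Fin.natAdd k j))})
      atTop (nhds (ENNReal.ofReal (tindW A W) ^ 2)) := by
  let P : Fin (k + k) × Fin (k + k) → ℕ → Prop := fun e c =>
    ∀ i j, i ≤ j → e = (Fin.castAdd k i, Fin.castAdd k j) ∨ e = (Fin.natAdd k i, Fin.natAdd k j) →
      c = A i j
  have hlim := tendsto_measure_forall_upperCorner hW μ X hX hA hconv P
  let g : (Fin k → ℝ) → ENNReal := fun y =>
    ∏ i, ∏ j, if i ≤ j then ENNReal.ofReal (W (y i) (y j) (A i j)) else 1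
  have hg : Measurable g := by
    refine Finset.measurable_prod _ fun i _ => Finset.measurable_prod _ fun j _ => ?_
    split_ifs
    exacts [hW.measurable_ofReal _ _ _, measurable_const]
  have hne : ∀ i j : Fin k, Fin.castAdd k i ≠ Fin.natAdd k j := fun i j h => by
    have := congrArg Fin.val h
    simp at this
    omega
  have hcast_le : ∀ i j : Fin k, Fin.castAdd k i ≤ Fin.castAdd k j ↔ i ≤ j := fun _ _ => Iff.rfl
  have hnat_le : ∀ i j : Fin k, Fin.natAdd k i ≤ Fin.natAdd k j ↔ i ≤ j := fun i j =>
    Fin.natAdd_le_natAdd_iff k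
  have hPcast : ∀ i j c, P (Fin.castAdd k i, Fin.castAdd k j) c ↔ (i ≤ j → c = A i j) := by
    intro i j c
    simp only [P, Prod.mk.injEq, Fin.castAdd_inj, hne, false_and, or_false]
    exact ⟨fun h hij => h i j hij ⟨rfl, rfl⟩, by rintro h _ _ hij ⟨rfl, rfl⟩; exact h hij⟩
  have hPnat : ∀ i j c, P (Fin.natAdd k i, Fin.natAdd k j) c ↔ (i ≤ j → c = A i j) := by
    intro i j c
    simp only [P, Prod.mk.injEq, Fin.natAdd_inj, (hne _ _).symm, false_and, false_or]
    exact ⟨fun h hij => h i j hij ⟨rfl, rfl⟩, by rintro h _ _ hij ⟨rfl, rfl⟩; exact h hij⟩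
  have hPcn : ∀ i j c, P (Fin.castAdd k i, Fin.natAdd k j) c := by
    intro i j c
    simp only [P, Prod.mk.injEq, hne, (hne _ _).symm, false_and, and_false, or_self,
      IsEmpty.forall_iff, implies_true]
  have hPnc : ∀ i j c, P (Fin.natAdd k i, Fin.castAdd k j) c := by
    intro i j c
    simp only [P, Prod.mk.injEq, hne, (hne _ _).symm, false_and, and_false, or_self,
      IsEmpty.forall_iff, implies_true]
  have hint : ∫⁻ x, ∏ e : Fin (k + k) × Fin (k + k),
      ∑' c, (if P e c then pairWeight W x e c else 0) ∂(Measure.pi fun _ => unifI) =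
      ENNReal.ofReal (tindW A W) ^ 2 := by
    have hae : ∀ᵐ x ∂(Measure.pi fun _ : Fin (k + k) => unifI),
        ∏ e : Fin (k + k) × Fin (k + k), ∑' c, (if P e c then pairWeight W x e c else 0) =
          g (fun i => x (Fin.castAdd k i)) * g fun i => x (Fin.natAdd k i) := by
      filter_upwards [ae_pi_unifI_mem_Icc (k + k)] with x hx
      rw [Fintype.prod_prod_type]
      simp only [Fin.prod_univ_add, hPcn, hPnc, if_true, tsum_pairWeight hW hx, prod_const_one,
        mul_one, one_mul]
      congr 1
      all_goals
        refine prod_congr rfl fun i _ => prod_congr rfl fun j _ => ?_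
        simp only [hPcast, hPnat]
        by_cases hij : i ≤ j
        · simp only [hij, forall_true_left, tsum_ite_eq, if_true]
          exact if_pos (by simpa only [hcast_le, hnat_le] using hij)
        · simpa [hij] using tsum_pairWeight hW hx _
    rw [lintegral_congr_ae hae, ← (measurePreserving_append unifI k k).lintegral_comp (by fun_prop)]
    simp only [Fin.append_left, Fin.append_right]
    rw [lintegral_prod_mul hg.aemeasurable hg.aemeasurable, hW.ofReal_tindW, sq]
  rw [hint] at hlim
  refine hlim.congr' ?_
  filter_upwards [eventually_ge_atTop (k + k)] with n hn
  congr 1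
  ext ω
  simp only [Set.mem_ofPred_eq, Prod.forall, Fin.forall_fin_add, hPcn, hPnc, hPcast, hPnat, hn,
    forall_true_left, implies_true, and_true, true_and]
  have hval : ∀ {i j : Fin (k + k)}, i ≤ j →
      upperCorner (k + k) (X n ω) (i, j) = X n ω (Fin.castLE hn i) (Fin.castLE hn j) := by
    intro i j hij
    simp only [upperCorner]
    rw [dif_pos ⟨hij, i.2.trans_le hn, j.2.trans_le hn⟩]
    rfl
  have hblock : ∀ ι : Fin k → Fin (k + k), (∀ i j, ι i ≤ ι j ↔ i ≤ j) →
      ((∀ i j, i ≤ j → upperCorner (k + k) (X n ω) (ι i, ι j) = A i j) ↔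
        ∀ i j, A i j = X n ω (Fin.castLE hn (ι i)) (Fin.castLE hn (ι j))) := by
    intro ι hι
    constructor
    · intro h i j
      rcases le_total i j with hij | hij
      · rw [← h i j hij, hval ((hι i j).2 hij)]
      · rw [hsymA, (hA n ω).1, ← h j i hij, hval ((hι j i).2 hij)]
    · intro h i j hij
      rw [hval ((hι i j).2 hij), h]
  rw [← hblock (Fin.castAdd k) hcast_le,
    ← hblock (Fin.natAdd k) hnat_le]

/-- Let `X_n` be vertex exchangeable random elements of `A_n` with
`X_n^{[k]} → X_W^{[k]}` in distribution for all `k` (i.e. `P(X_n^{[k]} = A) → t_=(A,W)`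
for all `A ∈ A_k`), for some multigraphon `W`.  Then for every `k` and `A ∈ A_k`,
`lim_n E[t_=(A,X_n)²] = t_=(A,W)²`, and consequently `Var(t_=(A,X_n)) → 0`. -/
theorem second_moment_of_hom_density
    (Ω : ℕ → Type) [∀ n, MeasurableSpace (Ω n)]
    (μ : ∀ n, Measure (Ω n)) (hprob : ∀ n, IsProbabilityMeasure (μ n))
    (X : ∀ n, Ω n → Fin n → Fin n → ℕ)
    (hXmeas : ∀ n, Measurable (X n))
    (hA : ∀ n ω, (∀ i j, X n ω i j = X n ω j i) ∧ ∀ i, 2 ∣ X n ω i i)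
    (hexch : ∀ n (τ : Equiv.Perm (Fin n)),
      Measure.map (fun ω => fun i j => X n ω (τ i) (τ j)) (μ n) =
        Measure.map (X n) (μ n))
    (W : ℝ → ℝ → ℕ → ℝ)
    (hmeas : ∀ c, Measurable fun p : ℝ × ℝ => W p.1 p.2 c)
    (hnonneg : ∀ x y c, 0 ≤ W x y c)
    (hsymW : ∀ x y c, W x y c = W y x c)
    (hsum : ∀ x ∈ Set.Icc (0:ℝ) 1, ∀ y ∈ Set.Icc (0:ℝ) 1, ∑' c : ℕ, W x y c = 1)
    (hodd : ∀ x ∈ Set.Icc (0:ℝ) 1, ∀ c : ℕ, W x x (2 * c + 1) = 0)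
    (hconv : ∀ (k : ℕ) (A : Fin k → Fin k → ℕ),
        (∀ i j, A i j = A j i) → (∀ i, 2 ∣ A i i) →
        Filter.Tendsto (fun n => ((μ n) {ω | cornerEq (X n ω) A}).toReal)
          Filter.atTop (nhds (tindW A W)))
    (k : ℕ) (A : Fin k → Fin k → ℕ)
    (hsymA : ∀ i j, A i j = A j i) (hevenA : ∀ i, 2 ∣ A i i) :
    Filter.Tendsto (fun n => ∫ ω, (tind A (X n ω)) ^ 2 ∂ μ n)
        Filter.atTop (nhds ((tindW A W) ^ 2)) ∧
    Filter.Tendsto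
        (fun n => (∫ ω, (tind A (X n ω)) ^ 2 ∂ μ n) -
          (∫ ω, tind A (X n ω) ∂ μ n) ^ 2)
        Filter.atTop (nhds 0) := by
  classical
  have hW : IsMultigraphon W := ⟨hmeas, hnonneg, hsum, hodd⟩
  have hgap : ∀ m : ℕ, Tendsto (fun n : ℕ => 1 - (n.descFactorial m : ℝ) / (n : ℝ) ^ m) atTop
      (nhds 0) := fun m => by
    simpa using (tendsto_descFactorial_div_pow m).const_sub 1
  have hcombine : ∀ {u v : ℕ → ℝ} {a : ℝ} (m : ℕ), Tendsto v atTop (nhds a) →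
      (∀ᶠ n in atTop, |u n - v n| ≤ 1 - (n.descFactorial m : ℝ) / (n : ℝ) ^ m) →
      Tendsto u atTop (nhds a) := fun m hv hle => by
    simpa using (squeeze_zero_norm' hle (hgap m)).add hv
  have hfirst : Tendsto (fun n => ∫ ω, tind A (X n ω) ∂ μ n) atTop (nhds (tindW A W)) := by
    refine hcombine k (hconv k A hsymA hevenA) ?_
    filter_upwards [eventually_ge_atTop (k + 1)] with n hn
    have hkn : k ≤ n := by omega
    have h := abs_integral_density_sub_le (μ n) hkn (by omega) (X n) (hXmeas n) (hexch n)
      fun B => ∀ i j, A i j = B i j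
    have hset : {ω | cornerEq (X n ω) A} =
        {ω | ∀ i j, A i j = X n ω (Fin.castLE hkn i) (Fin.castLE hkn j)} := Set.ext fun ω => ⟨fun h i j => (h i j _ _).symm, fun h i j _ _ => (h i j).symm⟩
    rw [hset]
    exact h
  have htW : 0 ≤ tindW A W :=
    ge_of_tendsto' (hconv k A hsymA hevenA) fun n => ENNReal.toReal_nonneg
  have hsecond : Tendsto (fun n => ∫ ω, (tind A (X n ω)) ^ 2 ∂ μ n) atTop
      (nhds ((tindW A W) ^ 2)) := by
    have hlim := (ENNReal.tendsto_toReal (by simp)).comp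
      (tendsto_measure_two_corners hW μ X hXmeas hA (hconv (k + k)) A hsymA)
    rw [ENNReal.toReal_pow, ENNReal.toReal_ofReal htW] at hlim
    refine hcombine (k + k) hlim ?_
    filter_upwards [eventually_ge_atTop (k + k + 1)] with n hn
    have hkn : k + k ≤ n := by omega
    have h := abs_integral_density_sub_le (μ n) hkn (by omega) (X n) (hXmeas n) (hexch n)
      fun B => (∀ i j, A i j = B (Fin.castAdd k i) (Fin.castAdd k j)) ∧
        ∀ i j, A i j = B (Fin.natAdd k i) (Fin.natAdd k j)
    simp_rw [tind_sq]
    convert h using 4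
    simp [hkn, Measure.real]
  refine ⟨hsecond, ?_⟩
  simpa using hsecond.sub (hfirst.pow 2)
end
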